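/- Let P : g → g be ad-equivariant and homogeneous of degree m ≥ 1, and let h, e ∈ g satisfy [h, e] = 2e. Then [e, P(e)] = 0 and [h, P(e)] = 2m·P(e); in particular, if P(e) ≠ 0 then P(e) is a primitive vector for the sl(2)-action: an eigenvector of ad h with eigenvalue 2m annihilated by ad e. -/

import Mathlib

/-- The **Euler identity** for a vector-valued function homogeneous of degree `m`. -/
theorem fderiv_apply_self_of_homogeneous {𝕜 E F : Type*} [NontriviallyNormedField 𝕜]
    [NormedAddCommGroup E] [NormedSpace 𝕜 E] [NormedAddCommGroup F] [NormedSpace 𝕜 F]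
    {f : E → F} {m : ℕ} (hhom : ∀ (t : 𝕜) (x : E), f (t • x) = t ^ m • f x)
    {x : E} (hf : DifferentiableAt 𝕜 f x) : fderiv 𝕜 f x x = (m : 𝕜) • f x := by
  have hline : HasDerivAt (fun t : 𝕜 => t • x) x 1 := by
    simpa using (hasDerivAt_id (1 : 𝕜)).smul_const x
  have hchain : HasDerivAt (fun t : 𝕜 => f (t • x)) (fderiv 𝕜 f x x) 1 :=
    HasFDerivAt.comp_hasDerivAt (f := fun t : 𝕜 => t • x) 1
      (by simpa using hf.hasFDerivAt) hline
  have hpow : HasDerivAt (fun t : 𝕜 => f (t • x)) ((m : 𝕜) • f x) 1 := by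
    simpa [hhom] using (hasDerivAt_pow m (1 : 𝕜)).smul_const (f x)
  exact hchain.unique hpow

theorem stmt {g : Type*} [NormedAddCommGroup g] [NormedSpace ℂ g] [FiniteDimensional ℂ g]
    -- `lie` is the Lie bracket of the finite-dimensional complex Lie algebra `g`,
    -- given as bilinear data so that it is compatible with the normed space structure.
    (lie : g →ₗ[ℂ] g →ₗ[ℂ] g)
    (lie_self : ∀ x : g, lie x x = 0)
    (lie_jacobi : ∀ x y z : g, lie x (lie y z) = lie (lie x y) z + lie y (lie x z))
    (P : g → g) (hP : ContDiff ℂ ⊤ P)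
    (hPeq : ∀ x y : g, fderiv ℂ P x (lie y x) = lie y (P x))
    (m : ℕ) (hm : 1 ≤ m)
    (hhom : ∀ (t : ℂ) (x : g), P (t • x) = t ^ m • P x)
    (h e : g) (hhe : lie h e = (2 : ℂ) • e) :
    lie e (P e) = 0 ∧ lie h (P e) = (2 * (m : ℂ)) • P e := by
  have hdiff : DifferentiableAt ℂ P e := hP.differentiable (by simp) e
  constructor
  · rw [← hPeq, lie_self, map_zero]
  · rw [← hPeq, hhe, map_smul, fderiv_apply_self_of_homogeneous hhom hdiff, smul_smul]
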